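/- Let k ≥ 2 be a natural number and P ≥ 1. Then the oscillatory integral v(α) = ∫_{−P}^{P} e(α ξ^k) dξ satisfies v(α) ≪ P (1 + P^k |α|)^{−1/k} uniformly for all real α, with an implicit constant depending only on k. -/

import Mathlib

open MeasureTheory

/-- e(t) = e^{2πit}. -/
noncomputable def eF (t : ℝ) : ℂ := Complex.exp (2 * Real.pi * Complex.I * t)

/-- v(α) = ∫_{−P}^{P} e(α ξ^k) dξ. -/
noncomputable def vInt (k : ℕ) (P α : ℝ) : ℂ := ∫ ξ in (-P)..P, eF (α * ξ ^ k)

theorem norm_eF (t : ℝ) : ‖eF t‖ = 1 := by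
  have h : eF t = Complex.exp ((2 * Real.pi * t : ℝ) * Complex.I) := by
    unfold eF
    congr 1
    push_cast
    ring
  rw [h, Complex.norm_exp_ofReal_mul_I]

theorem continuous_eF : Continuous eF := by
  unfold eF
  fun_prop

theorem continuous_eF_monomial (k : ℕ) (α : ℝ) : Continuous fun ξ : ℝ => eF (α * ξ ^ k) :=
  continuous_eF.comp (by fun_prop)

theorem hasDerivAt_eF_monomial (n : ℕ) (α x : ℝ) :
    HasDerivAt (fun ξ : ℝ => eF (α * ξ ^ (n + 1)))
      (2 * Real.pi * Complex.I * α * (n + 1) * (x : ℂ) ^ n * eF (α * x ^ (n + 1))) x := by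
  have h1 : HasDerivAt (fun ξ : ℝ => α * ξ ^ (n + 1)) (α * ((n + 1 : ℕ) * x ^ n)) x := by
    simpa using (hasDerivAt_pow (n + 1) x).const_mul α
  have h2 := ((h1.ofReal_comp).const_mul (2 * Real.pi * Complex.I : ℂ)).cexp
  unfold eF
  convert h2 using 1
  push_cast
  ring

/-- The first derivative test for the phase `α * ξ ^ (n + 1)` away from the origin. -/
theorem norm_integral_eF_monomial_le (n : ℕ) {α δ P : ℝ} (hα : α ≠ 0) (hδ : 0 < δ)
    (hP : δ ≤ P) :
    ‖∫ ξ in δ..P, eF (α * ξ ^ (n + 1))‖ ≤ (δ ^ n)⁻¹ / |α| := by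
  set C : ℂ := 2 * Real.pi * Complex.I * α * (n + 1) with hC
  have hn : (n + 1 : ℂ) ≠ 0 := by exact_mod_cast n.succ_ne_zero
  have hC0 : C ≠ 0 := by
    simp [hC, hα, hn, Real.pi_ne_zero]
  have hCnorm : 2 * |α| ≤ ‖C‖ := by
    have h1 : ‖C‖ = 2 * Real.pi * |α| * (n + 1) := by
      have : ‖(n + 1 : ℂ)‖ = n + 1 := by
        rw [← Nat.cast_succ, Complex.norm_natCast, Nat.cast_succ]
      simp [hC, this, abs_of_pos Real.pi_pos]
    rw [h1]
    have h2 : (1 : ℝ) ≤ Real.pi * (n + 1) := by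
      have := Real.pi_gt_three
      have : (0 : ℝ) ≤ n := n.cast_nonneg
      nlinarith
    nlinarith [abs_nonneg α]
  have hpos : ∀ x ∈ Set.uIcc δ P, 0 < x := fun x hx => by
    rw [Set.uIcc_of_le hP] at hx
    exact hδ.trans_le hx.1
  set w' : ℝ → ℝ := fun x => -(n * x ^ (n - 1)) / (x ^ n) ^ 2 with hw'
  have hw : ∀ x ∈ Set.uIcc δ P, HasDerivAt (fun x : ℝ => (x ^ n)⁻¹) (w' x) x := fun x hx =>
    (hasDerivAt_pow n x).inv (pow_ne_zero _ (hpos x hx).ne')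
  have hw'c : ContinuousOn w' (Set.uIcc δ P) := by
    refine ContinuousOn.div (by fun_prop) (by fun_prop) fun x hx => ?_
    exact pow_ne_zero _ (pow_ne_zero _ (hpos x hx).ne')
  have hw'i : IntervalIntegrable w' volume δ P := hw'c.intervalIntegrable
  have hparts := intervalIntegral.integral_mul_deriv_eq_deriv_mul
    (u := fun x : ℝ => (((x ^ n)⁻¹ : ℝ) : ℂ)) (u' := fun x => (w' x : ℂ))
    (fun x hx => (hw x hx).ofReal_comp) (fun x _ => hasDerivAt_eF_monomial n α x)
    (Complex.continuous_ofReal.comp_continuousOn hw'c).intervalIntegrable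
    (Continuous.intervalIntegrable
      (by have := continuous_eF_monomial (n + 1) α; fun_prop) _ _)
  have hlhs : ∫ x in δ..P, (((x ^ n)⁻¹ : ℝ) : ℂ) *
      (2 * Real.pi * Complex.I * α * (n + 1) * (x : ℂ) ^ n * eF (α * x ^ (n + 1)))
      = C * ∫ x in δ..P, eF (α * x ^ (n + 1)) := by
    rw [← intervalIntegral.integral_const_mul]
    refine intervalIntegral.integral_congr fun x hx => ?_
    have hx0 : (x : ℂ) ≠ 0 := by exact_mod_cast (hpos x hx).ne'
    simp only [← hC]
    push_cast
    field_simp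
  rw [hlhs] at hparts
  have hrem : ‖∫ x in δ..P, (w' x : ℂ) * eF (α * x ^ (n + 1))‖ ≤ (δ ^ n)⁻¹ - (P ^ n)⁻¹ := by
    have hint : ∫ x in δ..P, -w' x = (δ ^ n)⁻¹ - (P ^ n)⁻¹ := by
      rw [intervalIntegral.integral_neg, intervalIntegral.integral_eq_sub_of_hasDerivAt hw hw'i]
      ring
    rw [← hint]
    refine intervalIntegral.norm_integral_le_of_norm_le hP
      (Filter.Eventually.of_forall fun x hx => ?_) hw'i.neg
    have hx0 : 0 < x := hδ.trans hx.1
    rw [norm_mul, norm_eF, mul_one, Complex.norm_real, Real.norm_eq_abs, abs_of_nonpos]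
    simp only [hw', neg_div]
    exact neg_nonpos.2 (by positivity)
  have hP0 : 0 < P := hδ.trans_le hP
  have hbd : ∀ y : ℝ, 0 < y → ‖(((y ^ n)⁻¹ : ℝ) : ℂ) * eF (α * y ^ (n + 1))‖ = (y ^ n)⁻¹ :=
    fun y hy => by
      rw [norm_mul, norm_eF, mul_one, Complex.norm_real, Real.norm_eq_abs,
        abs_of_pos (by positivity)]
  have hmain : ‖C‖ * ‖∫ x in δ..P, eF (α * x ^ (n + 1))‖ ≤ 2 * (δ ^ n)⁻¹ := by
    rw [← norm_mul, hparts]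
    refine (norm_sub_le _ _).trans ?_
    have := norm_sub_le ((((P ^ n)⁻¹ : ℝ) : ℂ) * eF (α * P ^ (n + 1)))
      ((((δ ^ n)⁻¹ : ℝ) : ℂ) * eF (α * δ ^ (n + 1)))
    rw [hbd P hP0, hbd δ hδ] at this
    linarith
  rw [le_div_iff₀ (abs_pos.2 hα)]
  nlinarith [norm_nonneg (∫ x in δ..P, eF (α * x ^ (n + 1)))]

theorem norm_integral_eF_le (k : ℕ) (α a b : ℝ) :
    ‖∫ ξ in a..b, eF (α * ξ ^ k)‖ ≤ |b - a| := by
  simpa using intervalIntegral.norm_integral_le_of_norm_le_const (C := 1)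
    (fun x (_ : x ∈ Set.uIoc a b) => (norm_eF (α * x ^ k)).le)

theorem norm_integral_zero_eF_monomial_le (k : ℕ) (hk : k ≠ 0) {P : ℝ} (hP : 0 < P) (α : ℝ) :
    ‖∫ ξ in (0 : ℝ)..P, eF (α * ξ ^ k)‖
      ≤ 3 * (P * (1 + P ^ k * |α|) ^ (-(1 : ℝ) / k)) := by
  set δ := P * (1 + P ^ k * |α|) ^ (-(1 : ℝ) / k) with hδ
  have hX : 0 ≤ P ^ k * |α| := by positivity
  have hX1 : 0 < 1 + P ^ k * |α| := by positivity
  have hδ0 : 0 < δ := by positivity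
  have hδP : δ ≤ P := by
    refine mul_le_of_le_one_right hP.le (Real.rpow_le_one_of_one_le_of_nonpos (by linarith) ?_)
    exact div_nonpos_of_nonpos_of_nonneg (by norm_num) k.cast_nonneg
  have hδk : δ ^ k * (1 + P ^ k * |α|) = P ^ k := by
    have hk' : (k : ℝ) ≠ 0 := by exact_mod_cast hk
    rw [hδ, mul_pow, ← Real.rpow_mul_natCast hX1.le, div_mul_cancel₀ _ hk', Real.rpow_neg_one,
      mul_assoc, inv_mul_cancel₀ hX1.ne', mul_one]
  have hδk0 : 0 < δ ^ k := by positivity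
  rcases le_total (P ^ k * |α|) 1 with h | h
  · have h1 : P ≤ 2 * δ := by
      refine le_of_pow_le_pow_left₀ hk (by positivity) ?_
      have h2 : (2 : ℝ) ≤ 2 ^ k := by
        simpa using pow_le_pow_right₀ (one_le_two : (1 : ℝ) ≤ 2) (Nat.one_le_iff_ne_zero.2 hk)
      rw [mul_pow]
      nlinarith
    have h3 := norm_integral_eF_le k α 0 P
    rw [sub_zero, abs_of_pos hP] at h3
    linarith
  · have hα : α ≠ 0 := by
      rintro rfl
      norm_num at h
    obtain ⟨n, rfl⟩ := Nat.exists_eq_add_one_of_ne_zero hk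
    have h1 := norm_integral_eF_monomial_le n hα hδ0 hδP
    have h2 := norm_integral_eF_le (n + 1) α 0 δ
    rw [sub_zero, abs_of_pos hδ0] at h2
    have h3 : (δ ^ n)⁻¹ / |α| ≤ 2 * δ := by
      have ha := abs_pos.2 hα
      have h4 : 1 ≤ 2 * (δ ^ (n + 1) * |α|) := by
        have h5 : δ ^ (n + 1) * |α| * (1 + P ^ (n + 1) * |α|) = P ^ (n + 1) * |α| := by
          rw [mul_right_comm, hδk]
        by_contra! hlt
        have h6 := mul_lt_mul_of_pos_right hlt hX1
        linarith
      rw [div_le_iff₀ ha, inv_le_iff_one_le_mul₀ (by positivity)]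
      calc (1 : ℝ) ≤ 2 * (δ ^ (n + 1) * |α|) := h4
        _ = _ := by ring
    have hi := fun a b => (continuous_eF_monomial (n + 1) α).intervalIntegrable (μ := volume) a b
    rw [← intervalIntegral.integral_add_adjacent_intervals (hi 0 δ) (hi δ P)]
    refine (norm_add_le _ _).trans ?_
    linarith

/-- v(α) ≪ P (1 + P^k |α|)^{−1/k} uniformly for α ∈ ℝ and P ≥ 1, the implicit
constant depending only on k. -/
theorem stmt6 (k : ℕ) (hk : 2 ≤ k) :
    ∃ c : ℝ, 0 < c ∧ ∀ P : ℝ, 1 ≤ P → ∀ α : ℝ,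
      ‖vInt k P α‖ ≤ c * P * (1 + P ^ k * |α|) ^ (-(1 : ℝ) / k) := by
  refine ⟨6, by norm_num, fun P hP α => ?_⟩
  have hk0 : k ≠ 0 := by omega
  have hP0 : 0 < P := by linarith
  have hright := norm_integral_zero_eF_monomial_le k hk0 hP0 α
  have hleft := norm_integral_zero_eF_monomial_le k hk0 hP0 (α * (-1) ^ k)
  have habs : |α * (-1) ^ k| = |α| := by simp [abs_mul]
  have hneg : ∫ ξ in (-P)..0, eF (α * ξ ^ k) = ∫ ξ in (0 : ℝ)..P, eF (α * (-1) ^ k * ξ ^ k) := by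
    have h := intervalIntegral.integral_comp_neg (a := 0) (b := P)
      (fun ξ : ℝ => eF (α * ξ ^ k))
    rw [neg_zero] at h
    rw [← h]
    simp only [mul_assoc, ← mul_pow, neg_one_mul]
  rw [habs, ← hneg] at hleft
  have hi := fun a b => (continuous_eF_monomial k α).intervalIntegrable (μ := volume) a b
  rw [vInt, ← intervalIntegral.integral_add_adjacent_intervals (hi (-P) 0) (hi 0 P)]
  refine (norm_add_le _ _).trans ?_
  linarith
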